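/- Let m, n ∈ ℕ, n ≥ 2. There are constants C₁, C₂ > 0 depending only on m and n with the following property. For every nonnegative nonincreasing simple function f on (0,∞) with bounded support and every a ≥ 1, there exists a nonnegative radially symmetric function u : ℝⁿ → ℝ of class C^{m−1} that is m-times weakly differentiable, such that: (i) u(x) = 0 for every x ∈ ℝⁿ with ω_n|x|^n < a/8, where ω_n is the volume of the unit ball of ℝⁿ; (ii) for every rearrangement-invariant function norm ‖·‖_X̄ over (0,∞): ‖u^*‖_X̄ + ‖(|D^m u|)^*‖_X̄ ≤ C₁ ‖f‖_X̄; (iii) for every rearrangement-invariant function norm ‖·‖_Ȳ over (0,∞): ‖χ_{(a,∞)} f‖_Ȳ ≤ C₂ ‖u^*‖_Ȳ. Here u^* and (|D^m u|)^* are nonincreasing rearrangements with respect to Lebesgue measure on ℝⁿ. -/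

import Mathlib

open MeasureTheory Set Filter Topology
open scoped ENNReal NNReal

noncomputable section

/-- The nonincreasing rearrangement of an `ℝ≥0∞`-valued function with respect to `μ`:
`f^*(t) = inf {λ : μ({f > λ}) ≤ t}`. -/
def rearr {α : Type*} [MeasurableSpace α] (μ : Measure α) (f : α → ℝ≥0∞) (t : ℝ) : ℝ≥0∞ :=
  sInf {l : ℝ≥0∞ | μ {x | l < f x} ≤ ENNReal.ofReal t}

/-- A rearrangement-invariant function norm over the measure space `(α, μ)`, acting on
nonnegative (`ℝ≥0∞`-valued) measurable functions. -/
structure RINorm {α : Type*} [MeasurableSpace α] (μ : Measure α) where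
  N : (α → ℝ≥0∞) → ℝ≥0∞
  add_le : ∀ f g : α → ℝ≥0∞, Measurable f → Measurable g →
    N (fun x => f x + g x) ≤ N f + N g
  smul_eq : ∀ (c : ℝ≥0) (f : α → ℝ≥0∞), Measurable f →
    N (fun x => (c : ℝ≥0∞) * f x) = (c : ℝ≥0∞) * N f
  eq_zero_iff : ∀ f : α → ℝ≥0∞, Measurable f → (N f = 0 ↔ f =ᵐ[μ] 0)
  mono : ∀ f g : α → ℝ≥0∞, Measurable f → Measurable g →
    (∀ᵐ x ∂μ, f x ≤ g x) → N f ≤ N g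
  fatou : ∀ (F : ℕ → α → ℝ≥0∞) (f : α → ℝ≥0∞), (∀ k, Measurable (F k)) → Measurable f →
    (∀ᵐ x ∂μ, Monotone fun k => F k x) → (∀ᵐ x ∂μ, (⨆ k, F k x) = f x) →
    (⨆ k, N (F k)) = N f
  indicator_lt_top : ∀ E : Set α, MeasurableSet E → μ E < ∞ →
    N (E.indicator fun _ => 1) < ∞
  exists_integral_le : ∀ E : Set α, MeasurableSet E → μ E < ∞ → ∃ C : ℝ≥0∞, C < ∞ ∧
    ∀ f : α → ℝ≥0∞, Measurable f → (∫⁻ x in E, f x ∂μ) ≤ C * N f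
  rearr_invariant : ∀ f g : α → ℝ≥0∞, Measurable f → Measurable g →
    (∀ l : ℝ≥0∞, μ {x | l < f x} = μ {x | l < g x}) → N f = N g

/-- Lebesgue measure on `(0,∞)`. -/
def μI : Measure ℝ := volume.restrict (Set.Ioi (0 : ℝ))

/-- The fundamental function of an r.i. norm over `(0,∞)`: `φ_X(t) = ‖χ_(0,t)‖_X`. -/
def fund (X : RINorm μI) (t : ℝ) : ℝ≥0∞ := X.N ((Set.Ioo (0 : ℝ) t).indicator fun _ => 1)


/-- The nonincreasing rearrangement of a real-valued function. -/
def rearrR {α : Type*} [MeasurableSpace α] (μ : Measure α) (u : α → ℝ) (t : ℝ) : ℝ≥0∞ :=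
  rearr μ (fun x => ENNReal.ofReal |u x|) t

abbrev Euc (n : ℕ) := EuclideanSpace ℝ (Fin n)

/-- The `i`-th partial derivative of a function on `ℝⁿ`. -/
def pderiv1 {n : ℕ} (i : Fin n) (φ : Euc n → ℝ) : Euc n → ℝ :=
  fun x => fderiv ℝ φ x (EuclideanSpace.single i 1)

/-- Iterated `i`-th partial derivative. -/
def iterPderiv {n : ℕ} (i : Fin n) : ℕ → (Euc n → ℝ) → Euc n → ℝ
  | 0, φ => φ
  | k + 1, φ => pderiv1 i (iterPderiv i k φ)

/-- The partial derivative `∂^γ φ` for a multi-index `γ`. -/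
def multiPderiv {n : ℕ} (γ : Fin n → ℕ) (φ : Euc n → ℝ) : Euc n → ℝ :=
  (List.finRange n).foldr (fun i ψ => iterPderiv i (γ i) ψ) φ

/-- The degree `|γ|` of a multi-index. -/
def mdeg {n : ℕ} (γ : Fin n → ℕ) : ℕ := ∑ i, γ i

/-- `u` is `m`-times weakly differentiable on the open set `Ω ⊆ ℝⁿ`, with weak
derivatives `Du γ` for all multi-indices `γ` with `|γ| ≤ m`. -/
def HasWeakDerivsOn {n : ℕ} (Ω : Set (Euc n)) (m : ℕ) (u : Euc n → ℝ)
    (Du : (Fin n → ℕ) → Euc n → ℝ) : Prop :=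
  LocallyIntegrableOn u Ω volume ∧
  (∀ γ : Fin n → ℕ, mdeg γ ≤ m → LocallyIntegrableOn (Du γ) Ω volume) ∧
  ∀ γ : Fin n → ℕ, mdeg γ ≤ m → ∀ φ : Euc n → ℝ,
    ContDiff ℝ (⊤ : ℕ∞) φ → HasCompactSupport φ → tsupport φ ⊆ Ω →
    ∫ x in Ω, u x * multiPderiv γ φ x = (-1 : ℝ) ^ mdeg γ * ∫ x in Ω, Du γ x * φ x

/-- The Euclidean length `|D^m u|` of the vector of all weak derivatives of orders
`1, …, m`. -/
def DmLen {n : ℕ} (m : ℕ) (Du : (Fin n → ℕ) → Euc n → ℝ) (x : Euc n) : ℝ :=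
  Real.sqrt (∑ g : Fin n → Fin (m + 1),
    if 1 ≤ mdeg (fun i => (g i : ℕ)) ∧ mdeg (fun i => (g i : ℕ)) ≤ m
      then Du (fun i => (g i : ℕ)) x ^ 2 else 0)

/-- The volume `ω_n` of the unit ball of `ℝⁿ`. -/
def omegaN (n : ℕ) : ℝ := (volume (Metric.ball (0 : Euc n) 1)).toReal


/-! ### Rearrangements -/

lemma rearr_antitone {α : Type*} [MeasurableSpace α] (μ : Measure α) (f : α → ℝ≥0∞) :
    Antitone (rearr μ f) := by
  intro s t hst
  apply sInf_le_sInf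
  intro l hl
  exact le_trans hl (ENNReal.ofReal_le_ofReal hst)

lemma rearr_measurable {α : Type*} [MeasurableSpace α] (μ : Measure α) (f : α → ℝ≥0∞) :
    Measurable (rearr μ f) := (rearr_antitone μ f).measurable

lemma lt_rearr_iff {α : Type*} [MeasurableSpace α] (μ : Measure α) (f : α → ℝ≥0∞) (t : ℝ)
    (l : ℝ≥0∞) : l < rearr μ f t ↔ ENNReal.ofReal t < μ {x | l < f x} := by
  constructor
  · intro h
    by_contra! hc
    exact absurd (sInf_le (show l ∈ {l : ℝ≥0∞ | μ {x | l < f x} ≤ ENNReal.ofReal t} from hc))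
      (not_le.mpr h)
  · intro h
    by_contra! hc
    have hl : l ≠ ∞ := by
      rintro rfl
      simp at h
    obtain ⟨v, hv, hvl, hvt⟩ := exists_seq_strictAnti_tendsto' (lt_top_iff_ne_top.mpr hl)
    have h1 : ∀ k, μ {x | v k < f x} ≤ ENNReal.ofReal t := by
      intro k
      have : rearr μ f t < v k := lt_of_le_of_lt hc (hvl k).1
      obtain ⟨l', hl', hl'k⟩ := sInf_lt_iff.mp this
      exact le_trans (measure_mono fun x hx => lt_trans hl'k hx) hl'
    have h2 : {x | l < f x} = ⋃ k, {x | v k < f x} := by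
      ext x
      simp only [mem_ofPred_eq, mem_iUnion]
      constructor
      · intro hx
        exact ((tendsto_order.1 hvt).2 _ hx).exists
      · rintro ⟨k, hk⟩
        exact lt_trans (hvl k).1 hk
    have h3 : Monotone fun k => {x | v k < f x} := by
      intro i j hij x hx
      exact lt_of_le_of_lt (hv.antitone hij) hx
    rw [h2, h3.measure_iUnion] at h
    exact absurd (iSup_le h1) (not_le.mpr h)

lemma volume_lt (d : ℝ≥0∞) : μI {t | ENNReal.ofReal t < d} = d := by
  have hm : MeasurableSet {t : ℝ | ENNReal.ofReal t < d} :=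
    measurableSet_lt ENNReal.measurable_ofReal measurable_const
  rw [μI, Measure.restrict_apply hm]
  by_cases hd : d = ∞
  · subst hd
    simp
  · lift d to ℝ≥0 using hd
    have : {t | ENNReal.ofReal t < (d : ℝ≥0∞)} ∩ Ioi 0 = Ioo (0 : ℝ) d := by
      ext t
      simp only [mem_inter_iff, mem_ofPred_eq, mem_Ioi, mem_Ioo]
      constructor
      · rintro ⟨h1, h2⟩
        refine ⟨h2, ?_⟩
        rw [← ENNReal.ofReal_coe_nnreal] at h1
        exact (ENNReal.ofReal_lt_ofReal_iff_of_nonneg h2.le).1 h1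
      · rintro ⟨h1, h2⟩
        refine ⟨?_, h1⟩
        rw [← ENNReal.ofReal_coe_nnreal]
        exact (ENNReal.ofReal_lt_ofReal_iff_of_nonneg h1.le).2 h2
    rw [this]
    simp

lemma rearr_dist {α : Type*} [MeasurableSpace α] (μ : Measure α) (f : α → ℝ≥0∞) (l : ℝ≥0∞) :
    μI {t | l < rearr μ f t} = μ {x | l < f x} := by
  simp only [lt_rearr_iff]
  exact volume_lt _

lemma RINorm.dist_mono (X : RINorm μI) {g h : ℝ → ℝ≥0∞} (hg : Measurable g) (hh : Measurable h)
    (H : ∀ l : ℝ≥0∞, μI {t | l < g t} ≤ μI {t | l < h t}) : X.N g ≤ X.N h := by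
  rw [X.rearr_invariant g (rearr μI g) hg (rearr_measurable _ _) fun l => (rearr_dist _ _ l).symm,
    X.rearr_invariant h (rearr μI h) hh (rearr_measurable _ _) fun l => (rearr_dist _ _ l).symm]
  apply X.mono _ _ (rearr_measurable _ _) (rearr_measurable _ _)
  refine Eventually.of_forall fun t => ?_
  apply sInf_le_sInf
  intro l hl
  exact (H l).trans hl

/-! ### Balls -/

lemma omegaN_pos (n : ℕ) : 0 < omegaN n :=
  ENNReal.toReal_pos (Metric.measure_ball_pos volume _ one_pos).ne' measure_ball_lt_top.ne

lemma vol_closedBall (n : ℕ) (r : ℝ) (hr : 0 ≤ r) :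
    volume (Metric.closedBall (0 : Euc n) r) = ENNReal.ofReal (omegaN n * r ^ n) := by
  rw [Measure.addHaar_closedBall _ _ hr, mul_comm (omegaN n), ENNReal.ofReal_mul (by positivity),
    omegaN, ENNReal.ofReal_toReal measure_ball_lt_top.ne]
  simp

lemma upper_dist (n : ℕ) (hn : 2 ≤ n) (f : ℝ → ℝ≥0∞) (hf : AntitoneOn f (Ioi 0))
    (v : Euc n → ℝ) (c : ℝ≥0)
    (hv : ∀ x, x ≠ 0 → ENNReal.ofReal |v x| ≤ c * f (omegaN n * ‖x‖ ^ n)) (hv0 : v 0 = 0)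
    (l : ℝ≥0∞) :
    volume {x | l < ENNReal.ofReal |v x|} ≤ μI {t | l < c * f t} := by
  have hω := omegaN_pos n
  set T := μI {t | l < c * f t} with hT
  by_cases hTt : T = ∞
  · rw [hTt]; exact le_top
  have key : {x | l < ENNReal.ofReal |v x|} ⊆
      Metric.closedBall (0 : Euc n) ((T.toReal / omegaN n) ^ (1 / (n : ℝ))) := by
    intro x hx
    have hx0 : x ≠ 0 := by
      rintro rfl
      simp [hv0] at hx
    have hnx : 0 < ‖x‖ := norm_pos_iff.mpr hx0
    have ht : 0 < omegaN n * ‖x‖ ^ n := by positivity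
    have h1 : l < c * f (omegaN n * ‖x‖ ^ n) := lt_of_lt_of_le hx (hv x hx0)
    have h2 : Ioc 0 (omegaN n * ‖x‖ ^ n) ⊆ {t | l < c * f t} ∩ Ioi 0 := by
      intro s hs
      refine ⟨lt_of_lt_of_le h1 ?_, hs.1⟩
      gcongr
      exact hf hs.1 ht hs.2
    have h3 : ENNReal.ofReal (omegaN n * ‖x‖ ^ n) ≤ T := by
      have := measure_mono (μ := volume) h2
      rw [Real.volume_Ioc, sub_zero] at this
      refine this.trans ?_
      rw [hT, μI]
      exact Measure.le_restrict_apply _ _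
    have h4 : omegaN n * ‖x‖ ^ n ≤ T.toReal := (ENNReal.ofReal_le_iff_le_toReal hTt).1 h3
    rw [mem_closedBall_zero_iff]
    have h5 : ‖x‖ ^ n ≤ T.toReal / omegaN n := by
      rw [le_div_iff₀ hω]; linarith
    calc ‖x‖ = (‖x‖ ^ n) ^ (1 / (n : ℝ)) := by
          rw [one_div, Real.pow_rpow_inv_natCast (norm_nonneg _) (by omega)]
      _ ≤ _ := Real.rpow_le_rpow (by positivity) h5 (by positivity)
  refine (measure_mono key).trans ?_
  rw [vol_closedBall _ _ (by positivity), one_div, Real.rpow_inv_natCast_pow (by positivity)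
    (by omega), mul_div_cancel₀ _ hω.ne', ENNReal.ofReal_toReal hTt]

/-! ### Splitting -/

def Aset : Set ℝ := {t | Int.fract t < 1 / 2}

lemma Aset_meas : MeasurableSet Aset := measurableSet_lt measurable_fract measurable_const

lemma Aset_shift (t : ℝ) : t + 1 / 2 ∈ Aset ↔ t ∉ Aset := by
  simp only [Aset, mem_ofPred_eq]
  have h0 := Int.fract_nonneg t
  have h1 := Int.fract_lt_one t
  have e : Int.fract (t + 1 / 2) = Int.fract (Int.fract t + 1 / 2) := by
    rw [← Int.fract_add_intCast (Int.fract t + 1/2) ⌊t⌋]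
    congr 1
    rw [Int.fract]; ring
  rw [e]
  by_cases h : Int.fract t < 1 / 2
  · rw [Int.fract_eq_self.2 ⟨by linarith, by linarith⟩]
    simp only [h, not_true_eq_false, iff_false]; linarith
  · have : Int.fract (Int.fract t + 1 / 2) = Int.fract t + 1 / 2 - 1 := by
      rw [Int.fract_eq_iff]
      exact ⟨by linarith, by linarith, 1, by simp⟩
    rw [this]
    simp only [h, not_false_eq_true, iff_true]; linarith

lemma half_measure (A : Set ℝ) (hA : MeasurableSet A) (hs : ∀ t, t ∈ A → t + 1 / 2 ∉ A)
    (a T : ℝ) (haT : a ≤ T) :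
    volume (A ∩ Ioc a T) ≤ ENNReal.ofReal ((T - a) / 2 + 1 / 4) := by
  set S := A ∩ Ioc a T
  have hS : MeasurableSet S := hA.inter measurableSet_Ioc
  set S' := (fun t : ℝ => t + (-(1 / 2))) ⁻¹' S
  have hS' : volume S' = volume S := measure_preimage_add_right volume _ S
  have hd : Disjoint S S' := by
    rw [Set.disjoint_left]
    rintro t ⟨h1, _⟩ ⟨h2, _⟩
    have := hs _ h2
    simp at this
    exact this h1
  have h1 : volume S + volume S ≤ ENNReal.ofReal (T - a + 1 / 2) := by
    nth_rewrite 2 [← hS']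
    rw [← measure_union' hd hS]
    have : S ∪ S' ⊆ Ioc a (T + 1 / 2) := by
      rintro t (⟨_, h⟩ | ⟨_, h⟩)
      · exact ⟨h.1, by linarith [h.2]⟩
      · simp only [mem_Ioc] at h ⊢
        constructor <;> linarith [h.1, h.2]
    refine (measure_mono this).trans ?_
    rw [Real.volume_Ioc]
    apply ENNReal.ofReal_le_ofReal
    linarith
  have h2 : volume S ≠ ∞ := by
    intro h
    rw [h] at h1
    simp at h1
  rw [← ENNReal.ofReal_toReal h2] at h1 ⊢
  rw [← ENNReal.ofReal_add (by positivity) (by positivity),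
    ENNReal.ofReal_le_ofReal_iff (by linarith)] at h1
  apply ENNReal.ofReal_le_ofReal
  linarith

/-! ### Partial derivatives -/

/-- smooth function -/
def Sm {n : ℕ} (φ : Euc n → ℝ) : Prop := ContDiff ℝ ((⊤ : ℕ∞) : WithTop ℕ∞) φ

lemma Sm.pderiv1 {n : ℕ} {φ : Euc n → ℝ} (h : Sm φ) (i : Fin n) : Sm (pderiv1 i φ) := by
  unfold Sm _root_.pderiv1
  have h1 : ContDiff ℝ ((⊤ : ℕ∞) : WithTop ℕ∞) (fderiv ℝ φ) := h.fderiv_right (by simp)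
  exact h1.clm_apply contDiff_const

lemma Sm.iter {n : ℕ} {φ : Euc n → ℝ} (h : Sm φ) (i : Fin n) (k : ℕ) :
    Sm (iterPderiv i k φ) := by
  induction k with
  | zero => exact h
  | succ k ih => exact ih.pderiv1 i

lemma cs_pderiv1 {n : ℕ} {φ : Euc n → ℝ} (h : HasCompactSupport φ) (i : Fin n) :
    HasCompactSupport (pderiv1 i φ) :=
  (h.fderiv ℝ).comp_left (g := fun L : Euc n →L[ℝ] ℝ => L (EuclideanSpace.single i 1)) (by simp)

lemma cs_iter {n : ℕ} {φ : Euc n → ℝ} (h : HasCompactSupport φ) (i : Fin n) (k : ℕ) :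
    HasCompactSupport (iterPderiv i k φ) := by
  induction k with
  | zero => exact h
  | succ k ih => exact cs_pderiv1 ih i

lemma supp_pderiv1 {n : ℕ} (φ : Euc n → ℝ) (i : Fin n) :
    tsupport (pderiv1 i φ) ⊆ tsupport φ :=
  (tsupport_fderiv_apply_subset ℝ (EuclideanSpace.single i 1))

lemma supp_iter {n : ℕ} (φ : Euc n → ℝ) (i : Fin n) (k : ℕ) :
    tsupport (iterPderiv i k φ) ⊆ tsupport φ := by
  induction k with
  | zero => exact subset_rfl
  | succ k ih => exact (supp_pderiv1 _ i).trans ih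

/-- reversed order derivative along a list -/
def ldAux {n : ℕ} (γ : Fin n → ℕ) (L : List (Fin n)) (φ : Euc n → ℝ) : Euc n → ℝ :=
  L.foldl (fun ψ i => iterPderiv i (γ i) ψ) φ

lemma ibp1 {n : ℕ} {u φ : Euc n → ℝ} (hu : Sm u) (hφ : Sm φ) (hc : HasCompactSupport φ)
    (i : Fin n) : ∫ x, u x * pderiv1 i φ x = - ∫ x, pderiv1 i u x * φ x := by
  have := integral_mul_fderiv_eq_neg_fderiv_mul_of_integrable (μ := (volume : Measure (Euc n)))
    (f := u) (g := φ) (v := EuclideanSpace.single i 1) ?_ ?_ ?_ ?_ ?_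
  · exact this
  · exact ((hu.pderiv1 i).continuous.mul hφ.continuous).integrable_of_hasCompactSupport
      (hc.mul_left)
  · exact (hu.continuous.mul (hφ.pderiv1 i).continuous).integrable_of_hasCompactSupport
      ((cs_pderiv1 hc i).mul_left)
  · exact (hu.continuous.mul hφ.continuous).integrable_of_hasCompactSupport (hc.mul_left)
  · exact fun x _ => (hu.differentiable (by simp)).differentiableAt
  · exact fun x _ => (hφ.differentiable (by simp)).differentiableAt

lemma iterPderiv_comm {n : ℕ} (i : Fin n) (k : ℕ) (u : Euc n → ℝ) :
    iterPderiv i k (pderiv1 i u) = pderiv1 i (iterPderiv i k u) := by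
  induction k with
  | zero => rfl
  | succ k ih => simp only [iterPderiv, ih]

lemma ibp2 {n : ℕ} {φ : Euc n → ℝ} (hφ : Sm φ) (hc : HasCompactSupport φ)
    (i : Fin n) (k : ℕ) : ∀ {u : Euc n → ℝ}, Sm u →
    ∫ x, u x * iterPderiv i k φ x = (-1) ^ k * ∫ x, iterPderiv i k u x * φ x := by
  induction k with
  | zero => intro u hu; simp [iterPderiv]
  | succ k ih =>
    intro u hu
    have h1 := ibp1 hu (hφ.iter i k) (cs_iter hc i k) i
    simp only [iterPderiv]
    rw [h1, ih (hu.pderiv1 i), iterPderiv_comm]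
    ring

lemma foldr_good {n : ℕ} (γ : Fin n → ℕ) (L : List (Fin n)) {φ : Euc n → ℝ} (hφ : Sm φ)
    (hc : HasCompactSupport φ) :
    Sm (L.foldr (fun i ψ => iterPderiv i (γ i) ψ) φ) ∧
    HasCompactSupport (L.foldr (fun i ψ => iterPderiv i (γ i) ψ) φ) := by
  induction L with
  | nil => exact ⟨hφ, hc⟩
  | cons i L ih => exact ⟨ih.1.iter i _, cs_iter ih.2 i _⟩

lemma ibp3 {n : ℕ} (γ : Fin n → ℕ) {φ : Euc n → ℝ} (hφ : Sm φ) (hc : HasCompactSupport φ)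
    (L : List (Fin n)) : ∀ {u : Euc n → ℝ}, Sm u →
    ∫ x, u x * (L.foldr (fun i ψ => iterPderiv i (γ i) ψ) φ) x
      = (-1) ^ (L.map γ).sum * ∫ x, ldAux γ L u x * φ x := by
  induction L with
  | nil => intro u hu; simp [ldAux]
  | cons i L ih =>
    intro u hu
    have hg := foldr_good γ L hφ hc
    simp only [List.foldr_cons, List.map_cons, List.sum_cons]
    rw [ibp2 hg.1 hg.2 i (γ i) hu, ih (hu.iter i _), pow_add, mul_assoc]
    rfl

/-- reversed order multi-index derivative -/
def rder {n : ℕ} (γ : Fin n → ℕ) (φ : Euc n → ℝ) : Euc n → ℝ := ldAux γ (List.finRange n) φ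

lemma Sm.ldAux {n : ℕ} (γ : Fin n → ℕ) (L : List (Fin n)) : ∀ {φ : Euc n → ℝ}, Sm φ →
    Sm (ldAux γ L φ) := by
  induction L with
  | nil => intro φ h; exact h
  | cons i L ih => intro φ h; exact ih (h.iter i (γ i))

lemma cs_ldAux {n : ℕ} (γ : Fin n → ℕ) (L : List (Fin n)) : ∀ {φ : Euc n → ℝ},
    HasCompactSupport φ → HasCompactSupport (ldAux γ L φ) := by
  induction L with
  | nil => intro φ h; exact h
  | cons i L ih => intro φ h; exact ih (cs_iter h i (γ i))

lemma supp_ldAux {n : ℕ} (γ : Fin n → ℕ) (L : List (Fin n)) : ∀ (φ : Euc n → ℝ),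
    tsupport (ldAux γ L φ) ⊆ tsupport φ := by
  induction L with
  | nil => intro φ; exact subset_rfl
  | cons i L ih => intro φ; exact (ih _).trans (supp_iter φ i (γ i))

lemma weakDerivs {n : ℕ} (m : ℕ) {u : Euc n → ℝ} (hu : Sm u) :
    HasWeakDerivsOn Set.univ m u (fun γ => rder γ u) := by
  refine ⟨hu.continuous.locallyIntegrable.locallyIntegrableOn _, fun γ _ =>
    (hu.ldAux γ _).continuous.locallyIntegrable.locallyIntegrableOn _, ?_⟩
  intro γ _ φ hφ hc _
  simp only [Measure.restrict_univ]
  have := ibp3 γ hφ hc (List.finRange n) hu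
  have e : mdeg γ = ((List.finRange n).map γ).sum := by
    rw [mdeg, ← List.sum_ofFn, List.ofFn_eq_map]
  rw [e]
  exact this

/-! ### Convolution -/

/-- convolution -/
def cv {n : ℕ} (F φ : Euc n → ℝ) : Euc n → ℝ :=
  MeasureTheory.convolution F φ (ContinuousLinearMap.mul ℝ ℝ) volume

lemma cv_apply {n : ℕ} (F φ : Euc n → ℝ) (x : Euc n) : cv F φ x = ∫ t, F t * φ (x - t) := rfl

lemma cv_sm {n : ℕ} {F φ : Euc n → ℝ} (hF : LocallyIntegrable F volume) (hφ : Sm φ)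
    (hc : HasCompactSupport φ) : Sm (cv F φ) :=
  hc.contDiff_convolution_right _ hF hφ

lemma cv_pderiv1 {n : ℕ} {F φ : Euc n → ℝ} (hF : LocallyIntegrable F volume) (hφ : Sm φ)
    (hc : HasCompactSupport φ) (i : Fin n) : pderiv1 i (cv F φ) = cv F (pderiv1 i φ) := by
  funext x
  have h1 : ContDiff ℝ 1 φ := hφ.of_le (by simp)
  have := hc.hasFDerivAt_convolution_right (ContinuousLinearMap.mul ℝ ℝ) hF h1 x
  rw [pderiv1, cv, this.fderiv, convolution_precompR_apply _ hF (hc.fderiv ℝ)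
    (h1.continuous_fderiv one_ne_zero)]
  rfl

lemma cv_iter {n : ℕ} {F φ : Euc n → ℝ} (hF : LocallyIntegrable F volume) (hφ : Sm φ)
    (hc : HasCompactSupport φ) (i : Fin n) (k : ℕ) :
    iterPderiv i k (cv F φ) = cv F (iterPderiv i k φ) := by
  induction k with
  | zero => rfl
  | succ k ih =>
    simp only [iterPderiv, ih]
    exact cv_pderiv1 hF (hφ.iter i k) (cs_iter hc i k) i

lemma cv_ldAux {n : ℕ} {F : Euc n → ℝ} (hF : LocallyIntegrable F volume) (γ : Fin n → ℕ)
    (L : List (Fin n)) : ∀ {φ : Euc n → ℝ}, Sm φ → HasCompactSupport φ →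
    ldAux γ L (cv F φ) = cv F (ldAux γ L φ) := by
  induction L with
  | nil => intro φ _ _; rfl
  | cons i L ih =>
    intro φ h hc
    have := ih (h.iter i (γ i)) (cs_iter hc i (γ i))
    simp only [ldAux, List.foldl_cons] at this ⊢
    rw [cv_iter hF h hc, this]

lemma cv_bound {n : ℕ} {F φ : Euc n → ℝ} (hφ : Sm φ)
    (hc : HasCompactSupport φ) (δ : ℝ) (hs : tsupport φ ⊆ Metric.closedBall 0 δ) (x : Euc n)
    (B : ℝ) (hB : ∀ t, ‖x - t‖ ≤ δ → |F t| ≤ B) : |cv F φ x| ≤ B * ∫ y, |φ y| := by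
  have hi : Integrable φ volume := hφ.continuous.integrable_of_hasCompactSupport hc
  rw [cv_apply]
  have e : ∫ y, |φ y| = ∫ t, |φ (x - t)| := (integral_sub_left_eq_self (fun y => |φ y|) volume x).symm
  rw [e, ← integral_const_mul, ← Real.norm_eq_abs]
  apply norm_integral_le_of_norm_le ((hi.comp_sub_left x).abs.const_mul B)
  refine Eventually.of_forall fun t => ?_
  rw [Real.norm_eq_abs, abs_mul]
  by_cases h : ‖x - t‖ ≤ δ
  · exact mul_le_mul_of_nonneg_right (hB t h) (abs_nonneg _)
  · have : φ (x - t) = 0 := by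
      by_contra h0
      exact h (by simpa using hs (subset_tsupport φ h0))
    simp [this]

lemma cv_lower {n : ℕ} {F φ : Euc n → ℝ} (hF : LocallyIntegrable F volume) (hφ : Sm φ)
    (hc : HasCompactSupport φ) (h0 : ∀ x, 0 ≤ φ x) (h1 : ∫ y, φ y = 1)
    (δ : ℝ) (hs : tsupport φ ⊆ Metric.closedBall 0 δ) (x : Euc n)
    (B : ℝ) (hB : ∀ t, ‖x - t‖ ≤ δ → B ≤ F t) : B ≤ cv F φ x := by
  have hi : Integrable φ volume := hφ.continuous.integrable_of_hasCompactSupport hc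
  have hce := hc.convolutionExists_right (ContinuousLinearMap.mul ℝ ℝ) hF hφ.continuous x
  have e : ∫ t, φ (x - t) = 1 := by rw [← h1]; exact integral_sub_left_eq_self φ volume x
  have : B = ∫ t, B * φ (x - t) := by rw [integral_const_mul, e, mul_one]
  rw [this, cv_apply]
  apply integral_mono ((hi.comp_sub_left x).const_mul B) hce
  intro t
  by_cases h : ‖x - t‖ ≤ δ
  · exact mul_le_mul_of_nonneg_right (hB t h) (h0 _)
  · have : φ (x - t) = 0 := by
      by_contra h0
      exact h (by simpa using hs (subset_tsupport φ h0))
    simp [this]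

lemma cv_radial {n : ℕ} {F φ : Euc n → ℝ} (hF : ∀ x y, ‖x‖ = ‖y‖ → F x = F y)
    (hφ : ∀ x y, ‖x‖ = ‖y‖ → φ x = φ y) (x y : Euc n) (hxy : ‖x‖ = ‖y‖) :
    cv F φ x = cv F φ y := by
  set R := Submodule.reflection (Submodule.span ℝ {x - y})ᗮ
  have hR : R x = y := Submodule.reflection_sub hxy
  rw [cv_apply, cv_apply, ← R.measurePreserving.integral_comp
    R.toHomeomorph.measurableEmbedding (fun t => F t * φ (y - t))]
  congr 1
  funext t
  rw [hF (R t) t (R.norm_map t), hφ (y - R t) (x - t)]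
  rw [← hR, ← map_sub, R.norm_map]

lemma exists_bump (n : ℕ) (δ : ℝ) (hδ : 0 < δ) : ∃ φ : Euc n → ℝ, Sm φ ∧ HasCompactSupport φ ∧
    tsupport φ ⊆ Metric.closedBall 0 δ ∧ (∀ x, 0 ≤ φ x) ∧ (∀ x y, ‖x‖ = ‖y‖ → φ x = φ y) ∧
    ∫ y, φ y = 1 := by
  set ψ : Euc n → ℝ := fun x => Real.smoothTransition (δ ^ 2 - ‖x‖ ^ 2) with hψ
  have hsm : Sm ψ := Real.smoothTransition.contDiff.comp (contDiff_const.sub (contDiff_norm_sq ℝ))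
  have hsupp : ∀ x, ψ x ≠ 0 → x ∈ Metric.closedBall (0 : Euc n) δ := by
    intro x hx
    rw [mem_closedBall_zero_iff]
    by_contra! h
    apply hx
    apply Real.smoothTransition.zero_of_nonpos
    nlinarith
  have hts : tsupport ψ ⊆ Metric.closedBall 0 δ :=
    closure_minimal hsupp Metric.isClosed_closedBall
  have hc : HasCompactSupport ψ :=
    HasCompactSupport.intro (isCompact_closedBall 0 δ) fun x hx => by
      by_contra h; exact hx (hsupp x h)
  have hnn : ∀ x, 0 ≤ ψ x := fun x => Real.smoothTransition.nonneg _
  have hI : 0 < ∫ y, ψ y := by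
    apply hsm.continuous.integral_pos_of_hasCompactSupport_nonneg_nonzero hc hnn (x := 0)
    exact (Real.smoothTransition.pos_of_pos (by simp; positivity)).ne'
  have hrad : ∀ x y, ‖x‖ = ‖y‖ → ψ x = ψ y := fun x y h => by simp [hψ, h]
  obtain ⟨c, hc0⟩ : ∃ c, c = (∫ y, ψ y)⁻¹ := ⟨_, rfl⟩
  have hcpos : 0 < c := by rw [hc0]; positivity
  have hi : ∫ y, c * ψ y = 1 := by rw [integral_const_mul, hc0, inv_mul_cancel₀ hI.ne']
  clear_value ψ
  have hsm2 : Sm (fun x => c * ψ x) := by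
    unfold Sm at *
    exact contDiff_const.mul hsm
  refine ⟨fun x => c * ψ x, hsm2, HasCompactSupport.mul_left (f := fun _ => c) hc, ?_, ?_, ?_, hi⟩
  · refine (closure_mono ?_).trans hts
    intro x hx h
    exact hx (by simp [h])
  · intro x; exact mul_nonneg hcpos.le (hnn x)
  · intro x y h; simp [hrad x y h]

/-! ### Main construction -/

lemma exists_delta (n : ℕ) (hn : 2 ≤ n) : ∃ s δ : ℝ, 0 < s ∧ 0 < δ ∧ 8 * omegaN n * s ^ n = 1 ∧
    ∀ r, s ≤ r → (r + 2 * δ) ^ n ≤ 3 / 2 * r ^ n := by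
  have hω := omegaN_pos n
  have h1 : Tendsto (fun ε : ℝ => (1 + 2 * ε) ^ n) (𝓝[>] 0) (𝓝 1) := by
    have : Continuous fun ε : ℝ => (1 + 2 * ε) ^ n := by fun_prop
    have h := this.tendsto 0
    simp only [mul_zero, add_zero, one_pow] at h
    exact h.mono_left nhdsWithin_le_nhds
  obtain ⟨ε, hε, hε0⟩ := ((h1.eventually (gt_mem_nhds (show (1 : ℝ) < 3 / 2 by norm_num))).and
    self_mem_nhdsWithin).exists
  replace hε0 : 0 < ε := hε0
  have hs : 0 < (1 / (8 * omegaN n)) ^ ((n : ℝ)⁻¹) := by positivity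
  refine ⟨(1 / (8 * omegaN n)) ^ ((n : ℝ)⁻¹), ε * (1 / (8 * omegaN n)) ^ ((n : ℝ)⁻¹), hs,
    mul_pos hε0 hs, ?_, ?_⟩
  · rw [Real.rpow_inv_natCast_pow (by positivity) (by omega)]
    field_simp
  · intro r hr
    have hr0 : 0 < r := hs.trans_le hr
    calc (r + 2 * (ε * (1 / (8 * omegaN n)) ^ ((n : ℝ)⁻¹))) ^ n ≤ (r + 2 * (ε * r)) ^ n := by
          gcongr
      _ = (1 + 2 * ε) ^ n * r ^ n := by rw [← mul_pow]; ring
      _ ≤ _ := by gcongr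

lemma lower_dist (n : ℕ) (hn : 2 ≤ n) (s δ : ℝ) (hs : 0 < s) (hδ : 0 < δ)
    (hsω : 8 * omegaN n * s ^ n = 1) (hr : ∀ r, s ≤ r → (r + 2 * δ) ^ n ≤ 3 / 2 * r ^ n)
    (f : ℝ → ℝ≥0∞) (hf : AntitoneOn f (Ioi 0)) (hb : ∃ b : ℝ, ∀ t, b ≤ t → f t = 0)
    (a : ℝ) (ha : 1 ≤ a) (r0 : ℝ) (hr0 : s ≤ r0) (hr0a : 8 * omegaN n * r0 ^ n = a)
    (u : Euc n → ℝ)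
    (hu : ∀ x, r0 + 2 * δ ≤ ‖x‖ → f (omegaN n * (‖x‖ + 2 * δ) ^ n) ≤ ENNReal.ofReal |u x|)
    (A : Set ℝ) (hA : MeasurableSet A) (hAs : ∀ t, t ∈ A → t + 1 / 2 ∉ A) (l : ℝ≥0∞) :
    μI {t | l < A.indicator ((Ioi a).indicator f) t} ≤ volume {x | l < ENNReal.ofReal |u x|} := by
  have hω := omegaN_pos n
  set S : Set ℝ := {t | a < t ∧ l < f t} with hS
  have hsub : {t | l < A.indicator ((Ioi a).indicator f) t} ⊆ A ∩ S := by
    intro t ht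
    have ht' : l < A.indicator ((Ioi a).indicator f) t := ht
    by_cases h1 : t ∈ A
    · rw [indicator_of_mem h1] at ht'
      by_cases h2 : t ∈ Ioi a
      · rw [indicator_of_mem h2] at ht'
        exact ⟨h1, h2, ht'⟩
      · rw [indicator_of_notMem h2] at ht'
        exact absurd ht' not_lt_zero
    · rw [indicator_of_notMem h1] at ht'
      exact absurd ht' not_lt_zero
  have hle : μI {t | l < A.indicator ((Ioi a).indicator f) t} ≤ volume (A ∩ S) :=
    (measure_mono hsub).trans (Measure.restrict_apply_le _ _)
  refine hle.trans ?_
  rcases S.eq_empty_or_nonempty with hE | hne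
  · simp [hE]
  have hbdd : BddAbove S := by
    obtain ⟨b, hb⟩ := hb
    refine ⟨b, fun t ht => ?_⟩
    by_contra! h
    have := ht.2
    rw [hb t h.le] at this
    exact absurd this not_lt_zero
  obtain ⟨t, htS, hT⟩ := exists_lt_of_lt_csSup hne (show sSup S - 1 / 100 < sSup S by linarith)
  have hat : a < t := htS.1
  have htT : t ≤ sSup S := le_csSup hbdd htS
  have h1 : volume (A ∩ S) ≤ ENNReal.ofReal ((sSup S - a) / 2 + 1 / 4) := by
    refine le_trans (measure_mono ?_) (half_measure A hA hAs a (sSup S) (by linarith))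
    exact inter_subset_inter_right _ fun y hy => ⟨hy.1, le_csSup hbdd hy⟩
  refine h1.trans ?_
  set ρ := (t / omegaN n) ^ ((n : ℝ)⁻¹) with hρ
  have htpos : 0 < t := by linarith
  have hρn : omegaN n * ρ ^ n = t := by
    rw [hρ, Real.rpow_inv_natCast_pow (by positivity) (by omega)]
    field_simp
  have hρ0 : 0 ≤ ρ := by positivity
  have hsρ : s + 2 * δ ≤ ρ := by
    have h2 := hr s le_rfl
    have h3 : (s + 2 * δ) ^ n ≤ ρ ^ n := by
      have : omegaN n * (s + 2 * δ) ^ n ≤ omegaN n * ρ ^ n := by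
        have := mul_le_mul_of_nonneg_left h2 hω.le
        nlinarith
      exact le_of_mul_le_mul_left this hω
    exact le_of_pow_le_pow_left₀ (by omega) hρ0 h3
  have h4 := hr (ρ - 2 * δ) (by linarith)
  have h5 := hr r0 hr0
  rw [sub_add_cancel] at h4
  have h6 := mul_le_mul_of_nonneg_left h4 hω.le
  have h7 := mul_le_mul_of_nonneg_left h5 hω.le
  have hshell : Metric.closedBall (0 : Euc n) (ρ - 2 * δ) \ Metric.closedBall 0 (r0 + 2 * δ) ⊆
      {x | l < ENNReal.ofReal |u x|} := by
    rintro x ⟨hx1, hx2⟩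
    rw [mem_closedBall_zero_iff] at hx1 hx2
    refine lt_of_lt_of_le (lt_of_lt_of_le htS.2 ?_) (hu x (not_le.1 hx2).le)
    have hp : 0 < ‖x‖ + 2 * δ := by positivity
    apply hf _ htpos
    · rw [← hρn]
      gcongr
      linarith
    · exact mul_pos hω (pow_pos hp n)
  refine le_trans ?_ (measure_mono hshell)
  refine le_trans ?_ (le_measure_sdiff)
  rw [vol_closedBall _ _ (by linarith), vol_closedBall _ _ (by linarith),
    ← ENNReal.ofReal_sub _ (mul_nonneg hω.le (pow_nonneg (by linarith) _))]
  apply ENNReal.ofReal_le_ofReal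
  nlinarith

lemma DmLen_bound {n : ℕ} (m : ℕ) (Du : (Fin n → ℕ) → Euc n → ℝ) (x : Euc n) (B : ℝ) (hB : 0 ≤ B)
    (K : (Fin n → ℕ) → ℝ) (h : ∀ γ, |Du γ x| ≤ B * K γ) :
    |DmLen m Du x| ≤ Real.sqrt (∑ g : Fin n → Fin (m + 1), K (fun i => (g i : ℕ)) ^ 2) * B := by
  rw [DmLen, abs_of_nonneg (Real.sqrt_nonneg _)]
  apply Real.sqrt_le_iff.2
  refine ⟨by positivity, ?_⟩
  rw [mul_pow, Real.sq_sqrt (by positivity), Finset.sum_mul]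
  apply Finset.sum_le_sum
  intro g _
  split_ifs
  · rw [← mul_pow, ← sq_abs]
    have := h (fun i => (g i : ℕ))
    gcongr
    linarith
  · positivity

/-- construction of a radially symmetric Sobolev function supported far from
the origin whose norms are controlled by a given nonincreasing simple function `f`. -/
theorem construction_vanishing_at_infinity (m n : ℕ) (hm : 1 ≤ m) (hn : 2 ≤ n) :
    ∃ C₁ C₂ : ℝ, 0 < C₁ ∧ 0 < C₂ ∧
      ∀ f : ℝ → ℝ≥0∞, Measurable f → (Set.range f).Finite → (∀ t, f t ≠ ∞) →
        AntitoneOn f (Set.Ioi 0) → (∃ b : ℝ, ∀ t, b ≤ t → f t = 0) →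
        ∀ a : ℝ, 1 ≤ a →
          ∃ (u : Euc n → ℝ) (Du : (Fin n → ℕ) → Euc n → ℝ),
            (∀ x, 0 ≤ u x) ∧
            (∀ x y : Euc n, ‖x‖ = ‖y‖ → u x = u y) ∧
            ContDiff ℝ (m - 1 : ℕ) u ∧
            HasWeakDerivsOn Set.univ m u Du ∧
            (∀ x : Euc n, omegaN n * ‖x‖ ^ n < a / 8 → u x = 0) ∧
            (∀ X : RINorm μI,
              X.N (fun t => rearrR volume u t) + X.N (fun t => rearrR volume (DmLen m Du) t)
                ≤ ENNReal.ofReal C₁ * X.N f) ∧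
            (∀ Y : RINorm μI,
              Y.N ((Set.Ioi a).indicator f)
                ≤ ENNReal.ofReal C₂ * Y.N (fun t => rearrR volume u t)) := by
  have hω := omegaN_pos n
  obtain ⟨s, δ, hs, hδ, hsω, hr⟩ := exists_delta n hn
  obtain ⟨φ, hφ, hc, hsupp, hφ0, hφr, hφ1⟩ := exists_bump n δ hδ
  set K : (Fin n → ℕ) → ℝ := fun γ => ∫ y, |rder γ φ y| with hK
  set D : ℝ := Real.sqrt (∑ g : Fin n → Fin (m + 1), K (fun i => (g i : ℕ)) ^ 2) with hD
  have hD0 : 0 ≤ D := Real.sqrt_nonneg _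
  refine ⟨1 + D, 2, by positivity, by norm_num, ?_⟩
  intro f hfm hfr hft hfa hb a ha
  obtain ⟨r0, hr0, hr0a⟩ : ∃ r0, s ≤ r0 ∧ 8 * omegaN n * r0 ^ n = a := by
    have h1 : 8 * omegaN n * ((a / (8 * omegaN n)) ^ ((n : ℝ)⁻¹)) ^ n = a := by
      rw [Real.rpow_inv_natCast_pow (by positivity) (by omega)]
      field_simp
    refine ⟨_, ?_, h1⟩
    apply le_of_pow_le_pow_left₀ (n := n) (by omega) (by positivity)
    refine le_of_mul_le_mul_left ?_ (show 0 < 8 * omegaN n by positivity)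
    rw [h1, hsω]; exact ha
  have hr0p : 0 < r0 := hs.trans_le hr0
  set F : Euc n → ℝ := fun x =>
    if r0 + δ ≤ ‖x‖ then (f (omegaN n * (‖x‖ + δ) ^ n)).toReal else 0 with hF
  have hF0 : ∀ x, 0 ≤ F x := by
    intro x; simp only [hF]; split_ifs <;> simp
  have hFm : Measurable F := by
    apply Measurable.ite (measurableSet_le measurable_const measurable_norm) _ measurable_const
    exact (hfm.comp (by fun_prop)).ennreal_toReal
  obtain ⟨M, hM⟩ : ∃ M : ℝ, ∀ t, (f t).toReal ≤ M := by
    have : ((fun y : ℝ≥0∞ => y.toReal) '' Set.range f).Finite := hfr.image _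
    obtain ⟨M, hM⟩ := this.bddAbove
    exact ⟨M, fun t => hM ⟨f t, ⟨t, rfl⟩, rfl⟩⟩
  have hFM : ∀ x, ‖F x‖ ≤ M := by
    intro x
    rw [Real.norm_of_nonneg (hF0 x)]
    simp only [hF]
    split_ifs
    · exact hM _
    · exact le_trans ENNReal.toReal_nonneg (hM 0)
  have hFl : LocallyIntegrable F volume := by
    refine (locallyIntegrable_const M).mono hFm.aestronglyMeasurable
      (Eventually.of_forall fun x => ?_)
    exact (hFM x).trans (le_abs_self M)
  have hFrad : ∀ x y, ‖x‖ = ‖y‖ → F x = F y := by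
    intro x y h; simp only [hF, h]
  -- the basic bound
  have hFb : ∀ x t : Euc n, x ≠ 0 → ‖x - t‖ ≤ δ →
      |F t| ≤ (f (omegaN n * ‖x‖ ^ n)).toReal := by
    intro x t hx hxt
    rw [abs_of_nonneg (hF0 t)]
    simp only [hF]
    split_ifs with h
    · apply ENNReal.toReal_mono (hft _)
      have hx' : 0 < ‖x‖ := norm_pos_iff.2 hx
      have h1 : ‖x‖ ≤ ‖t‖ + δ := by
        have := norm_sub_norm_le x t
        linarith
      apply hfa (mul_pos hω (pow_pos hx' n))
      · exact mul_pos hω (pow_pos (by positivity) n)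
      · gcongr
    · exact ENNReal.toReal_nonneg
  have hFz : ∀ x t : Euc n, ‖x‖ < r0 → ‖x - t‖ ≤ δ → |F t| ≤ 0 := by
    intro x t hx hxt
    have h1 : ‖t‖ ≤ ‖x‖ + δ := by
      have := norm_sub_norm_le t x
      rw [norm_sub_rev] at this
      linarith
    simp only [hF]
    rw [if_neg (by linarith), abs_zero]
  set u := cv F φ with hu
  have hus : Sm u := cv_sm hFl hφ hc
  have hder : ∀ γ, rder γ u = cv F (rder γ φ) := fun γ => cv_ldAux hFl γ _ hφ hc
  have hu0 : ∀ x, 0 ≤ u x := fun x =>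
    cv_lower hFl hφ hc hφ0 hφ1 δ hsupp x 0 fun t _ => hF0 t
  have hφabs : ∫ y, |φ y| = 1 := by
    rw [← hφ1]; congr 1; funext y; exact abs_of_nonneg (hφ0 y)
  have huz : ∀ x : Euc n, ‖x‖ < r0 → u x = 0 := by
    intro x hx
    have := cv_bound (F := F) hφ hc δ hsupp x 0 fun t ht => hFz x t hx ht
    rw [zero_mul] at this
    exact abs_nonpos_iff.1 this
  have huB : ∀ x : Euc n, x ≠ 0 → |u x| ≤ (f (omegaN n * ‖x‖ ^ n)).toReal := by
    intro x hx
    have := cv_bound (F := F) hφ hc δ hsupp x _ fun t ht => hFb x t hx ht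
    rwa [hφabs, mul_one] at this
  have hDB : ∀ x : Euc n, x ≠ 0 → |DmLen m (fun γ => rder γ u) x| ≤
      D * (f (omegaN n * ‖x‖ ^ n)).toReal := by
    intro x hx
    apply DmLen_bound _ _ _ _ ENNReal.toReal_nonneg K
    intro γ
    simp only [hder]
    exact cv_bound (hφ.ldAux γ _) (cs_ldAux γ _ hc) δ ((supp_ldAux γ _ φ).trans hsupp) x _
      fun t ht => hFb x t hx ht
  have hD00 : DmLen m (fun γ => rder γ u) (0 : Euc n) = 0 := by
    have := DmLen_bound m (fun γ => rder γ u) 0 0 le_rfl K ?_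
    · rw [mul_zero] at this
      exact abs_nonpos_iff.1 this
    intro γ
    simp only [hder]
    exact cv_bound (hφ.ldAux γ _) (cs_ldAux γ _ hc) δ ((supp_ldAux γ _ φ).trans hsupp) 0 _
      fun t ht => hFz 0 t (by simpa using hr0p) ht
  have hlow : ∀ x : Euc n, r0 + 2 * δ ≤ ‖x‖ →
      f (omegaN n * (‖x‖ + 2 * δ) ^ n) ≤ ENNReal.ofReal |u x| := by
    intro x hx
    rw [abs_of_nonneg (hu0 x)]
    rw [ENNReal.le_ofReal_iff_toReal_le (hft _) (hu0 x)]
    apply cv_lower hFl hφ hc hφ0 hφ1 δ hsupp x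
    intro t ht
    have h1 : ‖t‖ ≤ ‖x‖ + δ := by
      have := norm_sub_norm_le t x
      rw [norm_sub_rev] at this
      linarith
    have h2 : ‖x‖ ≤ ‖t‖ + δ := by
      have := norm_sub_norm_le x t
      linarith
    simp only [hF]
    rw [if_pos (by linarith)]
    apply ENNReal.toReal_mono (hft _)
    apply hfa
    · exact mul_pos hω (pow_pos (by positivity) n)
    · exact mul_pos hω (pow_pos (by positivity) n)
    · exact mul_le_mul_of_nonneg_left (pow_le_pow_left₀ (by positivity) (by linarith) n) hω.le
  refine ⟨u, fun γ => rder γ u, hu0, cv_radial hFrad hφr, hus.of_le ?_, weakDerivs m hus, ?_, ?_,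
    ?_⟩
  · exact WithTop.coe_le_coe.2 (le_top : ((m - 1 : ℕ) : ℕ∞) ≤ ⊤)
  · intro x hx
    apply huz
    by_contra! h
    have : r0 ^ n ≤ ‖x‖ ^ n := by gcongr
    have := mul_le_mul_of_nonneg_left this hω.le
    linarith
  · intro X
    have key : ∀ (v : Euc n → ℝ) (c : ℝ), 0 ≤ c → v 0 = 0 →
        (∀ x, x ≠ 0 → |v x| ≤ c * (f (omegaN n * ‖x‖ ^ n)).toReal) →
        X.N (fun t => rearrR volume v t) ≤ ENNReal.ofReal c * X.N f := by
      intro v c hc0 hv0 hv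
      have h2 := X.smul_eq c.toNNReal f hfm
      change _ ≤ (c.toNNReal : ℝ≥0∞) * _
      rw [← h2]
      apply X.dist_mono (rearr_measurable _ _) (hfm.const_mul _)
      intro l
      refine (rearr_dist volume (fun x => ENNReal.ofReal |v x|) l).le.trans ?_
      apply upper_dist n hn f hfa v _ _ hv0
      intro x hx
      refine (ENNReal.ofReal_le_ofReal (hv x hx)).trans ?_
      rw [ENNReal.ofReal_mul hc0, ENNReal.ofReal_toReal (hft _)]
      rfl
    rw [ENNReal.ofReal_add zero_le_one hD0, add_mul]
    refine add_le_add (key u 1 zero_le_one (huz 0 (by simpa using hr0p)) ?_)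
      (key _ D hD0 hD00 hDB)
    intro x hx
    rw [one_mul]
    exact huB x hx
  · intro Y
    have hg : Measurable ((Set.Ioi a).indicator f) := hfm.indicator measurableSet_Ioi
    have hsplit : (Set.Ioi a).indicator f = fun t => Aset.indicator ((Set.Ioi a).indicator f) t +
        Asetᶜ.indicator ((Set.Ioi a).indicator f) t := by
      funext t
      exact (indicator_self_add_compl_apply Aset ((Set.Ioi a).indicator f) t).symm
    have key : ∀ A : Set ℝ, MeasurableSet A → (∀ t, t ∈ A → t + 1 / 2 ∉ A) →
        Y.N (A.indicator ((Set.Ioi a).indicator f)) ≤ Y.N (fun t => rearrR volume u t) := by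
      intro A hA hAs
      apply Y.dist_mono (hg.indicator hA) (rearr_measurable _ _)
      intro l
      refine le_trans ?_ (rearr_dist volume (fun x => ENNReal.ofReal |u x|) l).ge
      exact lower_dist n hn s δ hs hδ hsω hr f hfa hb a ha r0 hr0 hr0a u hlow A hA hAs l
    calc Y.N ((Set.Ioi a).indicator f)
        = Y.N (fun t => Aset.indicator ((Set.Ioi a).indicator f) t +
        Asetᶜ.indicator ((Set.Ioi a).indicator f) t) := by rw [← hsplit]
      _ ≤ _ := Y.add_le _ _ (hg.indicator Aset_meas) (hg.indicator Aset_meas.compl)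
      _ ≤ Y.N (fun t => rearrR volume u t) + Y.N (fun t => rearrR volume u t) :=
          add_le_add (key _ Aset_meas fun t ht h => (Aset_shift t).1 h ht)
            (key _ Aset_meas.compl fun t ht h => h ((Aset_shift t).2 ht))
      _ = _ := by rw [← two_mul]; simp

end
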